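/- arXiv:2210.00656 — 4 statements merged into one kernel-verified Lean document; each statement's English description precedes it below -/
import Mathlib

section
/- Fix an integer ν ≥ 3. For an even integer r with 4 ≤ r ≤ 2(ν−1), let N(r) be the number of ν-tuples (k_1,…,k_ν) of even integers with k_1 + ⋯ + k_ν = 0 and max_α k_α − min_α k_α = r. Then 2ν + Σ_{even r, 4 ≤ r ≤ 2(ν−1)} (2ν − r)·N(r) = 2·ν^{ν−1}. -/
/-- `max_α k_α − min_α k_α` for a tuple `k : Fin ν → ℤ` (with `ν > 0`). -/
def spread (ν : ℕ) (h : 0 < ν) (k : Fin ν → ℤ) : ℤ :=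
  Finset.univ.sup' ⟨⟨0, h⟩, Finset.mem_univ _⟩ k -
    Finset.univ.inf' ⟨⟨0, h⟩, Finset.mem_univ _⟩ k

section Spread

variable {ν : ℕ}

/-- The smallest component of a tuple of integers. -/
def tupleMin (ν : ℕ) (h : 0 < ν) (k : Fin ν → ℤ) : ℤ :=
  Finset.univ.inf' ⟨⟨0, h⟩, Finset.mem_univ _⟩ k

theorem tupleMin_le (h : 0 < ν) (k : Fin ν → ℤ) (α : Fin ν) : tupleMin ν h k ≤ k α :=
  Finset.inf'_le _ (Finset.mem_univ α)

theorem exists_eq_tupleMin (h : 0 < ν) (k : Fin ν → ℤ) : ∃ α, k α = tupleMin ν h k := by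
  obtain ⟨α, -, hα⟩ := Finset.exists_mem_eq_inf' (s := Finset.univ) ⟨⟨0, h⟩, Finset.mem_univ _⟩ k
  exact ⟨α, hα.symm⟩

theorem le_tupleMin_add_spread (h : 0 < ν) (k : Fin ν → ℤ) (α : Fin ν) :
    k α ≤ tupleMin ν h k + spread ν h k := by
  have := Finset.le_sup' k (Finset.mem_univ α)
  simp only [tupleMin, spread]
  linarith

theorem exists_eq_tupleMin_add_spread (h : 0 < ν) (k : Fin ν → ℤ) :
    ∃ α, k α = tupleMin ν h k + spread ν h k := by
  obtain ⟨α, -, hα⟩ := Finset.exists_mem_eq_sup' (s := Finset.univ) ⟨⟨0, h⟩, Finset.mem_univ _⟩ k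
  refine ⟨α, ?_⟩
  simp only [tupleMin, spread]
  linarith

theorem spread_nonneg (h : 0 < ν) (k : Fin ν → ℤ) : 0 ≤ spread ν h k := by
  linarith [tupleMin_le h k ⟨0, h⟩, le_tupleMin_add_spread h k ⟨0, h⟩]

/-- Positive affine maps with integer coefficients act on the minimum and the spread. -/
theorem tupleMin_spread_of_affine (h : 0 < ν) {f j : Fin ν → ℤ} {a c : ℤ} (ha : 0 ≤ a)
    (hf : ∀ α, f α = a * j α + c) :
    tupleMin ν h f = a * tupleMin ν h j + c ∧ spread ν h f = a * spread ν h j := by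
  obtain ⟨p, hp⟩ := exists_eq_tupleMin h j
  obtain ⟨q, hq⟩ := exists_eq_tupleMin_add_spread h j
  obtain ⟨p', hp'⟩ := exists_eq_tupleMin h f
  obtain ⟨q', hq'⟩ := exists_eq_tupleMin_add_spread h f
  have hmin : tupleMin ν h f = a * tupleMin ν h j + c := by
    have h₁ := tupleMin_le h f p
    have h₂ := mul_le_mul_of_nonneg_left (tupleMin_le h j p') ha
    rw [hf, hp] at h₁
    linarith [hf p']
  refine ⟨hmin, ?_⟩
  have h₁ := le_tupleMin_add_spread h f q
  have h₂ := mul_le_mul_of_nonneg_left (le_tupleMin_add_spread h j q') ha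
  rw [hf, hq] at h₁
  linarith [hf q']

/-- Tuples of even integers with sum zero and prescribed spread. -/
def evenTuples (ν : ℕ) (h : 0 < ν) (r : ℤ) : Set (Fin ν → ℤ) :=
  {k | (∀ α, Even (k α)) ∧ (∑ α, k α) = 0 ∧ spread ν h k = r}

/-- Tuples of residues in `[0, ν)` whose sum is divisible by `ν`. -/
noncomputable def residueTuples (ν : ℕ) : Finset (Fin ν → ℤ) :=
  (Fintype.piFinset fun _ => Finset.Ico (0 : ℤ) ν).filter fun f => (ν : ℤ) ∣ ∑ α, f α

theorem mem_residueTuples {f : Fin ν → ℤ} :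
    f ∈ residueTuples ν ↔ (∀ α, 0 ≤ f α ∧ f α < ν) ∧ (ν : ℤ) ∣ ∑ α, f α := by
  simp [residueTuples]

theorem card_residueTuples (h : 0 < ν) : (residueTuples ν).card = ν ^ (ν - 1) := by
  obtain ⟨m, rfl⟩ : ∃ m, ν = m + 1 := ⟨ν - 1, by omega⟩
  have hpos : (0 : ℤ) < ((m + 1 : ℕ) : ℤ) := by exact_mod_cast h
  have hcard : (Fintype.piFinset fun _ : Fin m => Finset.Ico (0 : ℤ) (m + 1 : ℕ)).card
      = (m + 1) ^ m := by
    simp only [Fintype.card_piFinset, Int.card_Ico, Finset.prod_const, Finset.card_univ,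
      Fintype.card_fin]
    congr 1
  rw [Nat.add_sub_cancel, ← hcard]
  refine Finset.card_nbij' (fun f => Fin.tail f)
    (fun g => Fin.cons ((-∑ i, g i) % ((m + 1 : ℕ) : ℤ)) g) ?_ ?_ ?_ ?_
  · intro f hf
    have hf' := (mem_residueTuples.1 hf).1
    simpa [Fin.tail] using fun i : Fin m => hf' i.succ
  · intro g hg
    have hg' : ∀ i, 0 ≤ g i ∧ g i < ((m + 1 : ℕ) : ℤ) := by simpa using hg
    refine mem_residueTuples.2 ⟨fun α => ?_, ?_⟩
    · refine Fin.cases ?_ (fun i => ?_) α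
      · exact ⟨Int.emod_nonneg _ hpos.ne', Int.emod_lt_of_pos _ hpos⟩
      · exact hg' i
    · rw [Fin.sum_univ_succ]
      simp only [Fin.cons_zero, Fin.cons_succ]
      refine Int.dvd_of_emod_eq_zero ?_
      rw [Int.emod_add_emod]
      simp
  · intro f hf
    obtain ⟨hb, hd⟩ := mem_residueTuples.1 hf
    have h0 : (-∑ i, Fin.tail f i) % ((m + 1 : ℕ) : ℤ) = f 0 := by
      rw [Fin.sum_univ_succ] at hd
      refine Eq.trans (Int.emod_eq_emod_iff_emod_sub_eq_zero.2 (Int.emod_eq_zero_of_dvd ?_))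
        (Int.emod_eq_of_lt (hb 0).1 (hb 0).2)
      have : -∑ i, Fin.tail f i - f 0 = -(f 0 + ∑ i : Fin m, f i.succ) := by
        simp only [Fin.tail]; ring
      rw [this]
      exact hd.neg_right
    simp only [h0]
    exact Fin.cons_self_tail f
  · intro g _
    exact Fin.tail_cons _ _

theorem exists_two_mul_of_even {k : Fin ν → ℤ} (hk : ∀ α, Even (k α)) :
    ∃ j : Fin ν → ℤ, k = fun α => 2 * j α := by
  choose j hj using hk
  exact ⟨j, funext fun α => by rw [hj]; ring⟩

/-- A residue tuple of spread `s` is a translate of half of a unique even tuple of sum zero and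
spread `2 * s`, and the translate is determined by its minimum. -/
theorem card_residueTuples_spread (h : 0 < ν) {s : ℕ} (hs : s < ν) :
    ((residueTuples ν).filter fun f => spread ν h f = s).card
      = (evenTuples ν h (2 * s)).ncard * (ν - s) := by
  have hpos : (0 : ℤ) < ν := by exact_mod_cast h
  have hIco : (Set.Ico (0 : ℤ) (ν - s : ℕ)).ncard = ν - s := by
    rw [← Finset.coe_Ico, Set.ncard_coe_finset]
    simp
  rw [← Set.ncard_coe_finset, ← hIco, ← Set.ncard_prod]
  symm
  refine Set.ncard_congr (fun p _ => fun α => p.1 α / 2 - tupleMin ν h p.1 / 2 + p.2) ?_ ?_ ?_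
  · rintro ⟨k, c⟩ ⟨⟨hk, hsum, hsp⟩, hc⟩
    obtain ⟨j, rfl⟩ := exists_two_mul_of_even hk
    obtain ⟨hm, hsp'⟩ := tupleMin_spread_of_affine h (f := fun α => 2 * j α) (j := j) (a := 2)
      (c := 0) (by norm_num) (by simp)
    obtain ⟨-, hsp₂⟩ := tupleMin_spread_of_affine h
      (f := fun α => j α - tupleMin ν h j + c) (j := j) (a := 1)
      (c := c - tupleMin ν h j) (by norm_num) (fun α => by ring)
    rw [← Finset.mul_sum] at hsum
    have hsum : ∑ α, j α = 0 := by linarith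
    have hj : spread ν h j = s := by linarith
    have hfun : (fun α => 2 * j α / 2 - tupleMin ν h (fun α => 2 * j α) / 2 + c)
        = fun α => j α - tupleMin ν h j + c := by
      funext α; rw [hm]; omega
    simp only [Set.mem_Ico] at hc
    simp only [hfun, Finset.coe_filter, Set.mem_ofPred_eq, mem_residueTuples]
    refine ⟨⟨fun α => ?_, ?_⟩, by linarith⟩
    · have := tupleMin_le h j α
      have := le_tupleMin_add_spread h j α
      omega
    · simp [Finset.sum_add_distrib, Finset.sum_sub_distrib, hsum]
  · rintro ⟨k, c⟩ ⟨k', c'⟩ ⟨⟨hk, hsum, -⟩, -⟩ ⟨⟨hk', hsum', -⟩, -⟩ heq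
    obtain ⟨j, rfl⟩ := exists_two_mul_of_even hk
    obtain ⟨j', rfl⟩ := exists_two_mul_of_even hk'
    obtain ⟨hm, -⟩ := tupleMin_spread_of_affine h (f := fun α => 2 * j α) (j := j) (a := 2)
      (c := 0) (by norm_num) (by simp)
    obtain ⟨hm', -⟩ := tupleMin_spread_of_affine h (f := fun α => 2 * j' α) (j := j') (a := 2)
      (c := 0) (by norm_num) (by simp)
    simp only [← Finset.mul_sum] at hsum hsum'
    have hsum : ∑ α, j α = 0 := by linarith
    have hsum' : ∑ α, j' α = 0 := by linarith
    have hpt : ∀ α, j α = j' α + (tupleMin ν h j - c - tupleMin ν h j' + c') := by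
      intro α
      have := congrFun heq α
      simp only [hm, hm'] at this
      omega
    have hzero : tupleMin ν h j - c - tupleMin ν h j' + c' = 0 := by
      have := Finset.sum_congr (rfl : (Finset.univ : Finset (Fin ν)) = _) fun α _ => hpt α
      rw [Finset.sum_add_distrib, hsum, hsum'] at this
      simpa [hpos.ne', h.ne'] using this.symm
    have hj : j = j' := funext fun α => by rw [hpt α, hzero, add_zero]
    subst hj
    simp only [Prod.mk.injEq, true_and]
    linarith
  · intro f hf
    simp only [Finset.coe_filter, Set.mem_ofPred_eq, mem_residueTuples] at hf
    obtain ⟨⟨hb, t, ht⟩, hsp⟩ := hf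
    obtain ⟨hm, hsp'⟩ := tupleMin_spread_of_affine h (f := fun α => 2 * (f α - t)) (j := f)
      (a := 2) (c := -2 * t) (by norm_num) (fun α => by ring)
    refine ⟨(fun α => 2 * (f α - t), tupleMin ν h f), ⟨⟨fun α => even_two_mul _, ?_, ?_⟩, ?_⟩, ?_⟩
    · simp [← Finset.mul_sum, Finset.sum_sub_distrib, ht]
    · rw [hsp', hsp]
    · obtain ⟨p, hp⟩ := exists_eq_tupleMin h f
      obtain ⟨q, hq⟩ := exists_eq_tupleMin_add_spread h f
      have := hb p
      have := hb q
      simp only [Set.mem_Ico]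
      omega
    · funext α
      simp only [hm]
      omega

theorem sum_evenTuples (h : 0 < ν) :
    ∑ s ∈ Finset.range ν, (evenTuples ν h (2 * s)).ncard * (ν - s) = ν ^ (ν - 1) := by
  rw [← card_residueTuples h,
    Finset.card_eq_sum_card_fiberwise (f := fun f => (spread ν h f).toNat) (t := Finset.range ν)]
  · refine Finset.sum_congr rfl fun s hs => ?_
    rw [← card_residueTuples_spread h (Finset.mem_range.1 hs)]
    congr 1
    refine Finset.filter_congr fun f _ => ?_
    have := spread_nonneg h f
    omega
  · intro f hf
    obtain ⟨hb, -⟩ := mem_residueTuples.1 hf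
    obtain ⟨p, hp⟩ := exists_eq_tupleMin h f
    obtain ⟨q, hq⟩ := exists_eq_tupleMin_add_spread h f
    have := hb p
    have := hb q
    simp only [Finset.coe_range, Set.mem_Iio]
    omega

theorem ncard_evenTuples_zero (h : 0 < ν) : (evenTuples ν h 0).ncard = 1 := by
  rw [Set.ncard_eq_one]
  refine ⟨0, Set.eq_singleton_iff_unique_mem.2 ⟨⟨by simp, by simp, ?_⟩, ?_⟩⟩
  · simpa using (tupleMin_spread_of_affine h (f := 0) (j := 0) (a := 0) (c := 0) le_rfl (by simp)).2
  · rintro k ⟨-, hsum, hsp⟩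
    have hk : ∀ α, k α = tupleMin ν h k := fun α =>
      le_antisymm (by simpa [hsp] using le_tupleMin_add_spread h k α) (tupleMin_le h k α)
    rw [Finset.sum_congr rfl fun α _ => hk α] at hsum
    have h0 : tupleMin ν h k = 0 := by simpa [h.ne'] using hsum
    exact funext fun α => (hk α).trans h0

/-- A tuple of spread one translated to have minimum zero has a sum strictly between `0` and `ν`. -/
theorem ncard_evenTuples_two (h : 0 < ν) : (evenTuples ν h 2).ncard = 0 := by
  suffices evenTuples ν h 2 = ∅ by simp [this]
  refine Set.eq_empty_iff_forall_notMem.2 ?_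
  rintro k ⟨hk, hsum, hsp⟩
  obtain ⟨j, rfl⟩ := exists_two_mul_of_even hk
  obtain ⟨-, hsp'⟩ := tupleMin_spread_of_affine h (f := fun α => 2 * j α) (j := j) (a := 2)
    (c := 0) (by norm_num) (by simp)
  have hj : spread ν h j = 1 := by linarith
  obtain ⟨p, hp⟩ := exists_eq_tupleMin h j
  obtain ⟨q, hq⟩ := exists_eq_tupleMin_add_spread h j
  have hsum : ∑ α, j α = 0 := by
    rw [← Finset.mul_sum] at hsum
    linarith
  have hlt : ∑ _α : Fin ν, tupleMin ν h j < ∑ α, j α :=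
    Finset.sum_lt_sum (fun α _ => tupleMin_le h j α) ⟨q, Finset.mem_univ q, by omega⟩
  have hgt : ∑ α, j α < ∑ _α : Fin ν, (tupleMin ν h j + 1) :=
    Finset.sum_lt_sum (fun α _ => hj ▸ le_tupleMin_add_spread h j α)
      ⟨p, Finset.mem_univ p, by omega⟩
  rw [hsum] at hlt hgt
  simp only [Finset.sum_const, Finset.card_univ, Fintype.card_fin, nsmul_eq_mul] at hlt hgt
  have h₁ := neg_of_mul_neg_right hlt (by positivity)
  have h₂ := pos_of_mul_pos_right hgt (by positivity)
  omega

end Spread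

theorem total_weighted_line_count
    (ν : ℕ) (hν : 3 ≤ ν) :
    2 * (ν : ℤ) +
      ∑ r ∈ (Finset.Icc (4 : ℤ) (2 * ((ν : ℤ) - 1))).filter (fun r => Even r),
        (2 * (ν : ℤ) - r) *
          ((Set.ncard {k : Fin ν → ℤ | (∀ α, Even (k α)) ∧ (∑ α, k α) = 0 ∧
              spread ν (by omega) k = r}) : ℤ)
      = 2 * (ν : ℤ) ^ (ν - 1) := by
  have h : 0 < ν := by omega
  have hreindex : ∑ r ∈ (Finset.Icc (4 : ℤ) (2 * ((ν : ℤ) - 1))).filter (fun r => Even r),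
      (2 * (ν : ℤ) - r) * ((evenTuples ν h r).ncard : ℤ)
      = ∑ s ∈ Finset.Ico 2 ν, 2 * (((evenTuples ν h (2 * s)).ncard * (ν - s) : ℕ) : ℤ) := by
    refine Finset.sum_nbij' (fun r => (r / 2).toNat) (fun s => 2 * (s : ℤ)) ?_ ?_ ?_ ?_ ?_
    · intro r hr
      simp only [Finset.mem_filter, Finset.mem_Icc, Finset.mem_Ico] at hr ⊢
      omega
    · intro s hs
      simp only [Finset.mem_filter, Finset.mem_Icc, Finset.mem_Ico] at hs ⊢
      exact ⟨by omega, even_two_mul _⟩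
    · intro r hr
      simp only [Finset.mem_filter, Finset.mem_Icc, Int.even_iff] at hr
      omega
    · intro s _
      simp
    · intro r hr
      simp only [Finset.mem_filter, Finset.mem_Icc, Int.even_iff] at hr
      have hr2 : 2 * ((r / 2).toNat : ℤ) = r := by omega
      rw [hr2, Nat.cast_mul, Nat.cast_sub (by omega)]
      linear_combination ((evenTuples ν h r).ncard : ℤ) * hr2
  have htotal := sum_evenTuples h
  rw [Finset.range_eq_Ico, Finset.sum_eq_sum_Ico_succ_bot h,
    Finset.sum_eq_sum_Ico_succ_bot (by omega)] at htotal
  simp only [Nat.cast_zero, mul_zero, zero_add, Nat.cast_one, mul_one, Nat.reduceAdd,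
    ncard_evenTuples_zero, ncard_evenTuples_two, one_mul, zero_mul, Nat.sub_zero] at htotal
  change 2 * (ν : ℤ) + ∑ r ∈ (Finset.Icc (4 : ℤ) (2 * ((ν : ℤ) - 1))).filter (fun r => Even r),
    (2 * (ν : ℤ) - r) * ((evenTuples ν h r).ncard : ℤ) = _
  rw [hreindex, ← Finset.mul_sum, ← mul_add]
  exact_mod_cast congrArg (2 * ·) htotal
end

section
/- Fix an integer ν ≥ 3. The number of ν-tuples (k_1,…,k_ν) of even integers satisfying k_1 + ⋯ + k_ν = 0 and 0 < max_α k_α − min_α k_α ≤ 2(ν−1) equals (1/ν)·[ν^ν − (ν−1)^ν − (ν−1)·(−1)^ν] − 1. -/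
open Finset

theorem spread_le_iff {n : ℕ} (h : 0 < n) (k : Fin n → ℤ) (c : ℤ) :
    spread n h k ≤ c ↔ ∀ i j, k i - k j ≤ c := by
  have hne : (univ : Finset (Fin n)).Nonempty := ⟨⟨0, h⟩, mem_univ _⟩
  unfold spread
  constructor
  · intro hs i j
    have hi := le_sup' k (mem_univ i)
    have hj := inf'_le k (mem_univ j)
    linarith
  · intro hs
    obtain ⟨i, -, hi⟩ := exists_mem_eq_sup' hne k
    obtain ⟨j, -, hj⟩ := exists_mem_eq_inf' hne k
    rw [hi, hj]
    exact hs i j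

theorem spread_pos_iff_of_sum_eq_zero {n : ℕ} (h : 0 < n) (k : Fin n → ℤ)
    (hk : ∑ i, k i = 0) : 0 < spread n h k ↔ k ≠ 0 := by
  rw [← not_le, spread_le_iff, not_iff_not]
  constructor
  · intro hs
    have hconst : ∀ i, k i = k ⟨0, h⟩ := fun i => by
      linarith [hs i ⟨0, h⟩, hs ⟨0, h⟩ i]
    have hzero : k ⟨0, h⟩ = 0 := by
      rw [sum_congr rfl fun i _ => hconst i] at hk
      simpa [h.ne'] using hk
    funext i
    rw [hconst i, hzero, Pi.zero_apply]
  · rintro rfl i j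
    simp

section ZeroSumTuples

variable {G : Type*} [AddCommGroup G] [Fintype G] [DecidableEq G]

/-- Dropping the first entry of a zero-sum tuple with entries in `A`. -/
theorem card_zero_sum_succ (A : Finset G) (j : ℕ) :
    #{y : Fin (j + 1) → G | (∀ i, y i ∈ A) ∧ ∑ i, y i = 0} =
      #{z : Fin j → G | (∀ i, z i ∈ A) ∧ -∑ i, z i ∈ A} := by
  refine card_nbij' (fun y => Fin.tail y) (fun z => Fin.cons (-∑ i, z i) z) ?_ ?_ ?_ ?_
  · intro y hy
    simp only [coe_filter, mem_univ, true_and, Set.mem_ofPred_eq, Fin.sum_univ_succ] at hy ⊢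
    refine ⟨fun i => hy.1 i.succ, ?_⟩
    have : -∑ i, Fin.tail y i = y 0 := (eq_neg_of_add_eq_zero_left hy.2).symm
    rw [this]
    exact hy.1 0
  · intro z hz
    simp only [coe_filter, mem_univ, true_and, Set.mem_ofPred_eq] at hz ⊢
    refine ⟨Fin.cases (by simpa using hz.2) (by simpa using hz.1), ?_⟩
    simp [Fin.sum_univ_succ]
  · intro y hy
    simp only [coe_filter, mem_univ, true_and, Set.mem_ofPred_eq, Fin.sum_univ_succ] at hy
    have : -∑ i, Fin.tail y i = y 0 := (eq_neg_of_add_eq_zero_left hy.2).symm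
    simp only [this, Fin.cons_self_tail]
  · intro z _
    simp

theorem card_zero_sum (j : ℕ) :
    #{y : Fin (j + 1) → G | ∑ i, y i = 0} = Fintype.card G ^ j := by
  simpa using card_zero_sum_succ (univ : Finset G) j

theorem card_ne_zero_zero_sum_succ_add (j : ℕ) :
    #{y : Fin (j + 1) → G | (∀ i, y i ≠ 0) ∧ ∑ i, y i = 0} +
      #{y : Fin j → G | (∀ i, y i ≠ 0) ∧ ∑ i, y i = 0} = (Fintype.card G - 1) ^ j := by
  have hrec := card_zero_sum_succ ({0}ᶜ : Finset G) j
  simp only [mem_compl, mem_singleton, neg_eq_zero] at hrec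
  have hall : #{y : Fin j → G | ∀ i, y i ≠ 0} = (Fintype.card G - 1) ^ j := by
    have : ({y : Fin j → G | ∀ i, y i ≠ 0} : Finset _) =
        Fintype.piFinset fun _ => ({0}ᶜ : Finset G) := by
      ext y
      simp
    rw [this, Fintype.card_piFinset_const, card_compl, card_singleton]
  rw [hrec, ← hall, add_comm, ← filter_filter, ← filter_filter]
  exact card_filter_add_card_filter_not _

theorem card_mul_card_ne_zero_zero_sum (j : ℕ) :
    (Fintype.card G : ℤ) * #{y : Fin j → G | (∀ i, y i ≠ 0) ∧ ∑ i, y i = 0} =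
      ((Fintype.card G : ℤ) - 1) ^ j + ((Fintype.card G : ℤ) - 1) * (-1) ^ j := by
  induction j with
  | zero => simp
  | succ j ih =>
    have hrec := congrArg (Nat.cast : ℕ → ℤ) (card_ne_zero_zero_sum_succ_add (G := G) j)
    rw [Nat.cast_add, Nat.cast_pow, Nat.cast_sub Fintype.card_pos, Nat.cast_one] at hrec
    rw [eq_sub_of_add_eq hrec, mul_sub, ih]
    ring

theorem card_mul_card_exists_zero_zero_sum {j : ℕ} (hj : 0 < j) :
    (Fintype.card G : ℤ) * #{y : Fin j → G | (∃ i, y i = 0) ∧ ∑ i, y i = 0} =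
      (Fintype.card G : ℤ) ^ j - ((Fintype.card G : ℤ) - 1) ^ j
        - ((Fintype.card G : ℤ) - 1) * (-1) ^ j := by
  obtain ⟨j, rfl⟩ := Nat.exists_eq_add_of_lt hj
  rw [zero_add]
  have hsplit := card_filter_add_card_filter_not
    (s := ({y : Fin (j + 1) → G | ∑ i, y i = 0} : Finset _)) (fun y => ∃ i, y i = 0)
  rw [card_zero_sum, filter_filter, filter_filter] at hsplit
  simp only [not_exists, and_comm (a := ∑ i, _ = (0 : G))] at hsplit
  have hcast := congrArg (Nat.cast : ℕ → ℤ) hsplit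
  rw [Nat.cast_add, Nat.cast_pow] at hcast
  have hne := card_mul_card_ne_zero_zero_sum (G := G) (j + 1)
  simp only [ne_eq] at hne
  rw [eq_sub_of_add_eq hcast, mul_sub, hne]
  ring

end ZeroSumTuples

/-- Twice the canonical representatives of a tuple of residues, shifted by twice their floored
mean. -/
def centeredLift (n : ℕ) (y : Fin n → ZMod n) (i : Fin n) : ℤ :=
  2 * ((y i).val - (∑ j, ((y j).val : ℤ)) / n)

theorem centeredLift_zero (n : ℕ) : centeredLift n 0 = 0 := by
  funext i
  simp [centeredLift]

theorem centeredLift_injOn (n : ℕ) :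
    Set.InjOn (centeredLift n) {y | ∃ i, y i = 0} := by
  rintro y ⟨i, hi⟩ z ⟨j, hj⟩ hyz
  rcases n.eq_zero_or_pos with rfl | hn
  · exact i.elim0
  have : NeZero n := ⟨hn.ne'⟩
  have hval : ∀ l, 2 * (((y l).val : ℤ) - (∑ j, ((y j).val : ℤ)) / n) =
      2 * (((z l).val : ℤ) - (∑ j, ((z j).val : ℤ)) / n) := fun l => congrFun hyz l
  have hyi : (y i).val = 0 := by simp [hi]
  have hzj : (z j).val = 0 := by simp [hj]
  funext l
  apply ZMod.val_injective n
  have h₁ := hval i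
  have h₂ := hval j
  have h₃ := hval l
  omega

theorem sum_centeredLift {n : ℕ} [NeZero n] {y : Fin n → ZMod n} (hy : ∑ i, y i = 0) :
    ∑ i, centeredLift n y i = 0 := by
  have hdvd : (n : ℤ) ∣ ∑ j, ((y j).val : ℤ) := by
    rw [← ZMod.intCast_zmod_eq_zero_iff_dvd]
    simpa using hy
  simp only [centeredLift]
  rw [← mul_sum, sum_sub_distrib, sum_const, card_univ, Fintype.card_fin, nsmul_eq_mul,
    Int.mul_ediv_cancel' hdvd, sub_self, mul_zero]

theorem exists_centeredLift_eq {n : ℕ} [NeZero n] {k : Fin n → ℤ} (heven : ∀ i, Even (k i))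
    (hsum : ∑ i, k i = 0) (hk : ∀ i j, k i - k j ≤ 2 * ((n : ℤ) - 1)) :
    ∃ y : Fin n → ZMod n, ((∃ i, y i = 0) ∧ ∑ i, y i = 0) ∧ centeredLift n y = k := by
  have hn : (n : ℤ) ≠ 0 := by exact_mod_cast NeZero.ne n
  choose m hm using heven
  obtain ⟨i₀, hi₀⟩ := Finite.exists_min m
  have hval : ∀ i, (((m i - m i₀ : ℤ) : ZMod n).val : ℤ) = m i - m i₀ := by
    intro i
    rw [ZMod.val_intCast]
    have h₁ := hk i i₀
    have h₂ := hm i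
    have h₃ := hm i₀
    have h₄ := hi₀ i
    exact Int.emod_eq_of_lt (by omega) (by omega)
  have hmsum : ∑ i, m i = 0 := by
    have : ∑ i, k i = ∑ i, m i + ∑ i, m i := by
      rw [← sum_add_distrib]
      exact sum_congr rfl fun i _ => hm i
    omega
  have hshift : ∑ i, (m i - m i₀) = n * (-m i₀) := by
    rw [sum_sub_distrib, hmsum]
    simp
  refine ⟨fun i => ((m i - m i₀ : ℤ) : ZMod n), ⟨⟨i₀, by simp⟩, ?_⟩, ?_⟩
  · rw [← Int.cast_sum, hshift]
    simp
  · funext i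
    simp only [centeredLift, hval, hshift, Int.mul_ediv_cancel_left _ hn]
    rw [hm i]
    ring

theorem image_centeredLift {n : ℕ} [NeZero n] (h : 0 < n) :
    {k : Fin n → ℤ | (∀ α, Even (k α)) ∧ (∑ α, k α) = 0 ∧
        0 < spread n h k ∧ spread n h k ≤ 2 * ((n : ℤ) - 1)} =
      centeredLift n ''
        (({y : Fin n → ZMod n | (∃ i, y i = 0) ∧ ∑ i, y i = 0} : Finset _).erase 0) := by
  ext k
  simp only [Set.mem_ofPred_eq, Set.mem_image, mem_coe, mem_erase, mem_filter, mem_univ, true_and]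
  constructor
  · rintro ⟨heven, hsum, hpos, hle⟩
    obtain ⟨y, hy, rfl⟩ := exists_centeredLift_eq heven hsum ((spread_le_iff h k _).1 hle)
    refine ⟨y, ⟨?_, hy⟩, rfl⟩
    rintro rfl
    exact (spread_pos_iff_of_sum_eq_zero h _ hsum).1 hpos (centeredLift_zero n)
  · rintro ⟨y, ⟨hne, hzero, hy⟩, rfl⟩
    have hsum := sum_centeredLift hy
    refine ⟨fun i => even_two_mul _, hsum, ?_, ?_⟩
    · rw [spread_pos_iff_of_sum_eq_zero h _ hsum]
      intro hlift
      exact hne (centeredLift_injOn n hzero ⟨⟨0, h⟩, rfl⟩ (hlift.trans (centeredLift_zero n).symm))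
    · rw [spread_le_iff]
      intro i j
      have hi := ZMod.val_lt (y i)
      simp only [centeredLift]
      omega

theorem count_even_tuples_of_interior_lines
    (ν : ℕ) (hν : 3 ≤ ν) :
    ((Set.ncard {k : Fin ν → ℤ | (∀ α, Even (k α)) ∧ (∑ α, k α) = 0 ∧
        0 < spread ν (by omega) k ∧ spread ν (by omega) k ≤ 2 * ((ν : ℤ) - 1)}) : ℤ)
      = ((ν : ℤ) ^ ν - ((ν : ℤ) - 1) ^ ν - ((ν : ℤ) - 1) * (-1) ^ ν) / (ν : ℤ) - 1 := by
  have hpos : 0 < ν := by omega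
  have : NeZero ν := ⟨hpos.ne'⟩
  have hmem : (0 : Fin ν → ZMod ν) ∈
      ({y : Fin ν → ZMod ν | (∃ i, y i = 0) ∧ ∑ i, y i = 0} : Finset _) := by
    simp
  have hcard := card_mul_card_exists_zero_zero_sum (G := ZMod ν) hpos
  rw [ZMod.card] at hcard
  rw [image_centeredLift hpos, Set.InjOn.ncard_image, Set.ncard_coe_finset,
    card_erase_of_mem hmem, Nat.cast_sub (card_pos.2 ⟨0, hmem⟩), Nat.cast_one, ← hcard,
    Int.mul_ediv_cancel_left _ (by exact_mod_cast hpos.ne')]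
  refine (centeredLift_injOn ν).mono fun y hy => ?_
  simp only [mem_coe, mem_erase, mem_filter] at hy
  exact hy.2.2.1
end

section
/- Fix an integer ν ≥ 3. The number of ν-tuples (k_1,…,k_ν) of integers such that k_α − k_β is divisible by 2ν for all α, β, k_1 + ⋯ + k_ν = 0, and 0 < max_α k_α − min_α k_α ≤ 2ν(ν−1), equals ν^ν − (ν−1)^ν − 1. (All components of such tuples are automatically even.) -/
theorem sub_le_spread {ν : ℕ} (h : 0 < ν) (k : Fin ν → ℤ) (α β : Fin ν) :
    k α - k β ≤ spread ν h k :=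
  sub_le_sub (Finset.le_sup' k (Finset.mem_univ α)) (Finset.inf'_le k (Finset.mem_univ β))

theorem exists_spread_eq_sub {ν : ℕ} (h : 0 < ν) (k : Fin ν → ℤ) :
    ∃ α β, spread ν h k = k α - k β ∧ ∀ γ, k β ≤ k γ := by
  obtain ⟨α, -, hα⟩ := Finset.exists_mem_eq_sup' ⟨⟨0, h⟩, Finset.mem_univ _⟩ k
  obtain ⟨β, -, hβ⟩ := Finset.exists_mem_eq_inf' ⟨⟨0, h⟩, Finset.mem_univ _⟩ k
  exact ⟨α, β, by rw [spread, hα, hβ], fun γ => hβ ▸ Finset.inf'_le k (Finset.mem_univ γ)⟩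

/-- Nonzero tuples with entries in `{0, …, ν - 1}`, at least one of which vanishes. -/
noncomputable def normalizedTuples (ν : ℕ) : Finset (Fin ν → ℤ) :=
  (Fintype.piFinset (fun _ => Finset.Ico 0 (ν : ℤ)) \
    Fintype.piFinset (fun _ => Finset.Ico 1 (ν : ℤ))).erase 0

theorem mem_normalizedTuples {ν : ℕ} {a : Fin ν → ℤ} :
    a ∈ normalizedTuples ν ↔
      (∃ α, a α ≠ 0) ∧ (∀ α, 0 ≤ a α ∧ a α < ν) ∧ ∃ α, a α = 0 := by
  simp only [normalizedTuples, Finset.mem_erase, Finset.mem_sdiff, Fintype.mem_piFinset,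
    Finset.mem_Ico, Function.ne_iff, Pi.zero_apply, not_forall]
  refine and_congr_right fun _ => and_congr_right fun h => exists_congr fun α => ?_
  have := h α
  lia

theorem card_normalizedTuples {ν : ℕ} (hν : 0 < ν) :
    ((normalizedTuples ν).card : ℤ) = (ν : ℤ) ^ ν - ((ν : ℤ) - 1) ^ ν - 1 := by
  have hsub : Fintype.piFinset (fun _ : Fin ν => Finset.Ico 1 (ν : ℤ)) ⊆
      Fintype.piFinset (fun _ => Finset.Ico 0 (ν : ℤ)) :=
    Fintype.piFinset_subset _ _ fun _ => Finset.Ico_subset_Ico_left zero_le_one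
  have hzero : (0 : Fin ν → ℤ) ∈ Fintype.piFinset (fun _ => Finset.Ico 0 (ν : ℤ)) \
      Fintype.piFinset (fun _ => Finset.Ico 1 (ν : ℤ)) := by
    simp only [Finset.mem_sdiff, Fintype.mem_piFinset, Finset.mem_Ico, Pi.zero_apply]
    exact ⟨fun _ => by lia, fun h => absurd (h ⟨0, hν⟩).1 (by norm_num)⟩
  rw [normalizedTuples, Finset.cast_card_erase_of_mem hzero, Finset.cast_card_sdiff hsub]
  simp only [Fintype.card_piFinset_const, Int.card_Ico, sub_zero, Int.toNat_natCast]
  push_cast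
  rw [Int.toNat_of_nonneg (by lia)]

/-- The zero-sum tuple with differences `2ν` times those of `a`. -/
def zeroSumTuple {ν : ℕ} (a : Fin ν → ℤ) (α : Fin ν) : ℤ :=
  2 * ν * a α - 2 * ∑ β, a β

theorem zeroSumTuple_sub {ν : ℕ} (a : Fin ν → ℤ) (α β : Fin ν) :
    zeroSumTuple a α - zeroSumTuple a β = 2 * ν * (a α - a β) := by
  unfold zeroSumTuple
  ring

theorem sum_zeroSumTuple {ν : ℕ} (a : Fin ν → ℤ) : ∑ α, zeroSumTuple a α = 0 := by
  simp only [zeroSumTuple, Finset.sum_sub_distrib, ← Finset.mul_sum, Finset.sum_const,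
    Finset.card_univ, Fintype.card_fin, nsmul_eq_mul]
  ring

theorem injOn_zeroSumTuple {ν : ℕ} (hν : 0 < ν) :
    Set.InjOn (zeroSumTuple (ν := ν)) (normalizedTuples ν) := by
  intro a ha b hb hab
  obtain ⟨-, ha, α, hα⟩ := mem_normalizedTuples.1 ha
  obtain ⟨-, hb, β, hβ⟩ := mem_normalizedTuples.1 hb
  have hdiff (γ δ : Fin ν) : a γ - a δ = b γ - b δ := by
    have h := zeroSumTuple_sub a γ δ
    rw [hab, zeroSumTuple_sub b γ δ] at h
    exact (mul_left_cancel₀ (by positivity) h).symm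
  ext γ
  have := hdiff γ α
  have := hdiff α β
  have := (ha β).1
  have := (hb α).1
  lia

theorem image_zeroSumTuple {ν : ℕ} (hν : 0 < ν) :
    zeroSumTuple '' (normalizedTuples ν : Set (Fin ν → ℤ)) =
      {k : Fin ν → ℤ | (∀ α β, (2 * (ν : ℤ)) ∣ (k α - k β)) ∧ (∑ α, k α) = 0 ∧
        0 < spread ν hν k ∧ spread ν hν k ≤ 2 * (ν : ℤ) * ((ν : ℤ) - 1)} := by
  have hpos : (0 : ℤ) < 2 * ν := by positivity
  ext k
  constructor
  · rintro ⟨a, ha, rfl⟩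
    obtain ⟨⟨γ, hγ⟩, ha, δ, hδ⟩ := mem_normalizedTuples.1 ha
    refine ⟨fun α β => ⟨_, zeroSumTuple_sub a α β⟩, sum_zeroSumTuple a, ?_, ?_⟩
    · refine lt_of_lt_of_le ?_ (sub_le_spread hν _ γ δ)
      rw [zeroSumTuple_sub]
      have := (ha γ).1
      exact mul_pos hpos (by lia)
    · obtain ⟨α, β, h, -⟩ := exists_spread_eq_sub hν (zeroSumTuple a)
      rw [h, zeroSumTuple_sub]
      have := (ha α).2
      have := (ha β).1
      exact mul_le_mul_of_nonneg_left (by lia) hpos.le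
  · rintro ⟨hdvd, hsum, hspread, hle⟩
    obtain ⟨γ, β, h, hmin⟩ := exists_spread_eq_sub hν k
    choose a ha using fun α => hdvd α β
    refine ⟨a, mem_normalizedTuples.2 ⟨⟨γ, fun h0 => ?_⟩, fun α => ⟨?_, ?_⟩, β, ?_⟩, ?_⟩
    · rw [h, ha, h0, mul_zero] at hspread
      exact hspread.false
    · exact nonneg_of_mul_nonneg_right (ha α ▸ sub_nonneg.2 (hmin α)) hpos
    · have hα := (sub_le_spread hν k α β).trans hle
      rw [ha] at hα
      have := le_of_mul_le_mul_left hα hpos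
      lia
    · simpa [hν.ne'] using ha β
    · have hβ : k β = -2 * ∑ α, a α := by
        have hs : ∑ α, (k α - k β) = ∑ α, 2 * (ν : ℤ) * a α :=
          Finset.sum_congr rfl fun α _ => ha α
        rw [Finset.sum_sub_distrib, hsum, ← Finset.mul_sum, Finset.sum_const, Finset.card_univ,
          Fintype.card_fin, nsmul_eq_mul] at hs
        have hne : (ν : ℤ) ≠ 0 := by positivity
        exact mul_left_cancel₀ hne (by linarith)
      ext α
      rw [zeroSumTuple, ← ha α, hβ]
      ring

theorem count_tuples_for_second_moment
    (ν : ℕ) (hν : 3 ≤ ν) :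
    ((Set.ncard {k : Fin ν → ℤ | (∀ α β, (2 * (ν : ℤ)) ∣ (k α - k β)) ∧ (∑ α, k α) = 0 ∧
        0 < spread ν (by omega) k ∧ spread ν (by omega) k ≤ 2 * (ν : ℤ) * ((ν : ℤ) - 1)}) : ℤ)
      = (ν : ℤ) ^ ν - ((ν : ℤ) - 1) ^ ν - 1 ∧
    ∀ k : Fin ν → ℤ,
      k ∈ {k : Fin ν → ℤ | (∀ α β, (2 * (ν : ℤ)) ∣ (k α - k β)) ∧ (∑ α, k α) = 0 ∧
        0 < spread ν (by omega) k ∧ spread ν (by omega) k ≤ 2 * (ν : ℤ) * ((ν : ℤ) - 1)} →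
      ∀ α, Even (k α) := by
  rw [← image_zeroSumTuple (by omega)]
  constructor
  · rw [(injOn_zeroSumTuple (by omega)).ncard_image, Set.ncard_coe_finset,
      card_normalizedTuples (by omega)]
  · rintro _ ⟨a, -, rfl⟩ α
    exact ⟨ν * a α - ∑ β, a β, by unfold zeroSumTuple; ring⟩
end

section
/- Fix an integer ν ≥ 3. Summing the quantity max_α k_α − min_α k_α over all ν-tuples (k_1,…,k_ν) of integers such that k_α − k_β is divisible by 2ν for all α, β, k_1 + ⋯ + k_ν = 0, and 0 < max_α k_α − min_α k_α ≤ 2ν(ν−1), yields exactly 2ν(ν−1)·ν^ν − 2ν²·(ν−1)^ν. Consequently, Σ over these tuples (together with the all-zero tuple) of the quantity (2ν − (max_α k_α − min_α k_α)/ν) equals 2·ν^ν. -/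
open Finset

theorem spread_eq_sub {ν : ℕ} (h : 0 < ν) {k : Fin ν → ℤ} {a b : Fin ν}
    (ha : ∀ i, k a ≤ k i) (hb : ∀ i, k i ≤ k b) : spread ν h k = k b - k a := by
  unfold spread
  congr 1
  · exact le_antisymm (Finset.sup'_le _ _ fun i _ => hb i) (Finset.le_sup' k (mem_univ b))
  · exact le_antisymm (Finset.inf'_le k (mem_univ a)) (Finset.le_inf' _ _ fun i _ => ha i)

theorem spread_zero {ν : ℕ} (h : 0 < ν) : spread ν h (fun _ => 0) = 0 := by
  simpa using spread_eq_sub h (k := fun _ => 0) (a := ⟨0, h⟩) (b := ⟨0, h⟩)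
    (fun _ => le_rfl) fun _ => le_rfl

theorem exists_le_and_exists_ge {ν : ℕ} (h : 0 < ν) {R : Type*} [LinearOrder R] (k : Fin ν → R) :
    (∃ a, ∀ i, k a ≤ k i) ∧ ∃ b, ∀ i, k i ≤ k b := by
  have : Nonempty (Fin ν) := ⟨⟨0, h⟩⟩
  exact ⟨Finite.exists_min k, Finite.exists_max k⟩

/-- Tuples of naturals below `n` with smallest component `0`. -/
def reducedTuples (ν n : ℕ) : Finset (Fin ν → ℕ) :=
  Fintype.piFinset (fun _ => range n) \ Fintype.piFinset (fun _ => Ico 1 n)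

theorem mem_reducedTuples {ν n : ℕ} {m : Fin ν → ℕ} :
    m ∈ reducedTuples ν n ↔ (∀ i, m i < n) ∧ ∃ a, m a = 0 := by
  simp only [reducedTuples, mem_sdiff, Fintype.mem_piFinset, mem_range, mem_Ico, not_forall]
  refine and_congr_right fun h => exists_congr fun a => ?_
  have := h a
  omega

theorem card_reducedTuples (ν n : ℕ) (hn : 0 < n) :
    ((reducedTuples ν n).card : ℤ) = (n : ℤ) ^ ν - ((n : ℤ) - 1) ^ ν := by
  have hsub : Fintype.piFinset (fun _ : Fin ν => Ico 1 n) ⊆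
      Fintype.piFinset (fun _ : Fin ν => range n) :=
    Fintype.piFinset_subset _ _ fun _ i hi => by simp at hi ⊢; omega
  rw [reducedTuples, cast_card_sdiff hsub]
  simp [Nat.cast_sub (Nat.succ_le_of_lt hn)]

/-- Every tuple of naturals below `n` is uniquely a reduced tuple plus a constant. -/
theorem sum_sub_sup_reducedTuples {ν : ℕ} (h : 0 < ν) (n : ℕ) :
    ∑ m ∈ reducedTuples ν n, (n - univ.sup m) = n ^ ν := by
  have hcard : ((reducedTuples ν n).sigma fun m => range (n - univ.sup m)).card =
      (Fintype.piFinset fun _ : Fin ν => range n).card := by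
    refine card_bij (fun p _ i => p.1 i + p.2) ?_ ?_ ?_
    · rintro ⟨m, s⟩ hp
      simp only [mem_sigma, mem_range, Fintype.mem_piFinset] at hp ⊢
      intro i
      have := Finset.le_sup (f := m) (mem_univ i)
      omega
    · rintro ⟨m, s⟩ hp ⟨m', s'⟩ hp' heq
      simp only [mem_sigma, mem_reducedTuples] at hp hp'
      obtain ⟨⟨-, a, ha⟩, -⟩ := hp
      obtain ⟨⟨-, b, hb⟩, -⟩ := hp'
      have hs : s = s' := by
        have h1 := congrFun heq a
        have h2 := congrFun heq b
        simp only at h1 h2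
        omega
      subst hs
      have hm : m = m' := funext fun i => by simpa using congrFun heq i
      rw [hm]
    · intro f hf
      simp only [mem_range, Fintype.mem_piFinset] at hf
      obtain ⟨a, ha⟩ := (exists_le_and_exists_ge h f).1
      refine ⟨⟨fun i => f i - f a, f a⟩, ?_, ?_⟩
      · simp only [mem_sigma, mem_reducedTuples, mem_range]
        refine ⟨⟨fun i => by have := hf i; omega, a, by simp⟩, ?_⟩
        have hn := hf a
        have : univ.sup (fun i => f i - f a) < n - f a := by
          rw [Finset.sup_lt_iff (by simpa using hn)]
          intro i _
          have := hf i
          have := ha i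
          omega
        omega
      · funext i
        exact Nat.sub_add_cancel (ha i)
  simpa using hcard

/-- The zero-sum tuple, with components congruent modulo `2ν`, attached to `m`. -/
def balancedTuple (ν : ℕ) (m : Fin ν → ℕ) : Fin ν → ℤ :=
  fun i => 2 * (ν : ℤ) * m i - 2 * ∑ j, (m j : ℤ)

theorem spread_balancedTuple {ν : ℕ} (h : 0 < ν) {m : Fin ν → ℕ} (hm : ∃ a, m a = 0) :
    spread ν h (balancedTuple ν m) = 2 * (ν : ℤ) * (univ.sup m : ℕ) := by
  obtain ⟨a, ha⟩ := hm
  obtain ⟨b, hb⟩ := (exists_le_and_exists_ge h m).2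
  have hsup : univ.sup m = m b :=
    le_antisymm (Finset.sup_le fun i _ => hb i) (Finset.le_sup (mem_univ b))
  rw [spread_eq_sub h (a := a) (b := b), hsup]
  · simp [balancedTuple, ha]
  · intro i
    simp only [balancedTuple, ha]
    gcongr
    exact Nat.zero_le _
  · intro i
    simp only [balancedTuple]
    gcongr
    exact hb i

theorem balancedTuple_injOn {ν : ℕ} (h : 0 < ν) (n : ℕ) :
    Set.InjOn (balancedTuple ν) (reducedTuples ν n) := by
  intro m hm m' hm' heq
  obtain ⟨-, a, ha⟩ := mem_reducedTuples.1 hm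
  obtain ⟨-, b, hb⟩ := mem_reducedTuples.1 hm'
  have hν : (0 : ℤ) < ν := by exact_mod_cast h
  have hi : ∀ i, 2 * (ν : ℤ) * m i - 2 * ∑ j, (m j : ℤ) =
      2 * (ν : ℤ) * m' i - 2 * ∑ j, (m' j : ℤ) := fun i => congrFun heq i
  have h1 := hi a
  have h2 := hi b
  rw [ha] at h1
  rw [hb] at h2
  have h3 : 0 ≤ 2 * (ν : ℤ) * m' a := by positivity
  have h4 : 0 ≤ 2 * (ν : ℤ) * m b := by positivity
  push_cast at h1 h2
  funext i
  have h5 : 2 * (ν : ℤ) * m i = 2 * (ν : ℤ) * m' i := by linarith [hi i]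
  exact_mod_cast mul_left_cancel₀ (by positivity) h5

theorem sum_balancedTuple (ν : ℕ) (m : Fin ν → ℕ) : ∑ i, balancedTuple ν m i = 0 := by
  simp only [balancedTuple, sum_sub_distrib, ← mul_sum, sum_const, card_univ, Fintype.card_fin,
    nsmul_eq_mul]
  ring

theorem exists_balancedTuple_eq {ν : ℕ} (h : 0 < ν) {k : Fin ν → ℤ}
    (hdvd : ∀ i j, (2 * (ν : ℤ)) ∣ k i - k j) (hsum : ∑ i, k i = 0)
    (hle : spread ν h k ≤ 2 * (ν : ℤ) * ((ν : ℤ) - 1)) :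
    ∃ m ∈ reducedTuples ν ν, balancedTuple ν m = k := by
  obtain ⟨⟨a, ha⟩, b, hb⟩ := exists_le_and_exists_ge h k
  rw [spread_eq_sub h ha hb] at hle
  have hν : (0 : ℤ) < ν := by exact_mod_cast h
  have hm : ∀ i, ∃ n : ℕ, k i - k a = 2 * (ν : ℤ) * n := by
    intro i
    obtain ⟨c, hc⟩ := hdvd i a
    have hc0 : 0 ≤ c := by
      have := ha i
      by_contra! hneg
      nlinarith
    exact ⟨c.toNat, by rw [Int.toNat_of_nonneg hc0, hc]⟩
  choose m hm using hm
  refine ⟨m, mem_reducedTuples.2 ⟨fun i => ?_, a, ?_⟩, ?_⟩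
  · have h1 : 2 * (ν : ℤ) * m i ≤ 2 * (ν : ℤ) * ((ν : ℤ) - 1) := by linarith [hm i, hb i]
    have h2 : (m i : ℤ) ≤ ν - 1 := le_of_mul_le_mul_left h1 (by positivity)
    omega
  · have := hm a
    simpa [h.ne'] using this
  · have h1 : ∑ i, (k i - k a) = 2 * (ν : ℤ) * ∑ i, (m i : ℤ) := by
      rw [mul_sum]
      exact sum_congr rfl fun i _ => hm i
    rw [sum_sub_distrib, hsum] at h1
    simp only [sum_const, card_univ, Fintype.card_fin, nsmul_eq_mul] at h1
    have h2 : k a = -(2 * ∑ i, (m i : ℤ)) :=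
      mul_left_cancel₀ hν.ne' (by linarith)
    funext i
    simp only [balancedTuple]
    linarith [hm i]

/-- The tuples in question are the nonzero balanced tuples of reduced tuples. -/
theorem setOf_spread_eq {ν : ℕ} (h : 0 < ν) :
    {k : Fin ν → ℤ | (∀ α β, (2 * (ν : ℤ)) ∣ (k α - k β)) ∧ (∑ α, k α) = 0 ∧
        0 < spread ν h k ∧ spread ν h k ≤ 2 * (ν : ℤ) * ((ν : ℤ) - 1)} =
      (((reducedTuples ν ν).image (balancedTuple ν)).erase fun _ => 0 : Finset (Fin ν → ℤ)) := by
  ext k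
  simp only [Set.mem_ofPred_eq, coe_erase, coe_image, Set.mem_sdiff, Set.mem_image, mem_coe,
    Set.mem_singleton_iff]
  constructor
  · rintro ⟨hdvd, hsum, hpos, hle⟩
    refine ⟨exists_balancedTuple_eq h hdvd hsum hle, ?_⟩
    rintro rfl
    exact hpos.ne' (spread_zero h)
  · rintro ⟨⟨m, hm, rfl⟩, hne⟩
    obtain ⟨hlt, hz⟩ := mem_reducedTuples.1 hm
    have hν : (0 : ℤ) < ν := by exact_mod_cast h
    refine ⟨fun i j => ⟨m i - m j, by simp only [balancedTuple]; ring⟩,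
      sum_balancedTuple ν m, ?_, ?_⟩
    · rw [spread_balancedTuple h hz]
      have hsup : 0 < univ.sup m := by
        rw [Nat.pos_iff_ne_zero]
        intro h0
        refine hne (funext fun i => ?_)
        have hm0 : ∀ i, m i = 0 := fun i =>
          Nat.le_zero.1 (h0 ▸ Finset.le_sup (f := m) (mem_univ i))
        simp [balancedTuple, hm0]
      positivity
    · rw [spread_balancedTuple h hz]
      have hsup : univ.sup m < ν := (Finset.sup_lt_iff h).2 fun i _ => hlt i
      gcongr
      omega

theorem zero_mem_image_balancedTuple {ν : ℕ} (h : 0 < ν) :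
    (fun _ => 0) ∈ (reducedTuples ν ν).image (balancedTuple ν) :=
  mem_image.2 ⟨fun _ => 0, mem_reducedTuples.2 ⟨fun _ => h, ⟨0, h⟩, rfl⟩, by
    funext i
    simp [balancedTuple]⟩

theorem sum_sub_sup_reducedTuples_int {ν : ℕ} (h : 0 < ν) :
    ∑ m ∈ reducedTuples ν ν, ((ν : ℤ) - (univ.sup m : ℕ)) = (ν : ℤ) ^ ν := by
  rw [← Nat.cast_pow, ← sum_sub_sup_reducedTuples h ν, Nat.cast_sum]
  refine sum_congr rfl fun m hm => ?_
  have hsup : univ.sup m < ν := (Finset.sup_lt_iff h).2 fun i _ => (mem_reducedTuples.1 hm).1 i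
  rw [Nat.cast_sub hsup.le]

theorem sum_of_spreads_for_second_moment
    (ν : ℕ) (hν : 3 ≤ ν) :
    (∑ᶠ k ∈ {k : Fin ν → ℤ | (∀ α β, (2 * (ν : ℤ)) ∣ (k α - k β)) ∧ (∑ α, k α) = 0 ∧
        0 < spread ν (by omega) k ∧ spread ν (by omega) k ≤ 2 * (ν : ℤ) * ((ν : ℤ) - 1)},
      spread ν (by omega) k)
      = 2 * (ν : ℤ) * ((ν : ℤ) - 1) * (ν : ℤ) ^ ν - 2 * (ν : ℤ) ^ 2 * ((ν : ℤ) - 1) ^ ν ∧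
    (∑ᶠ k ∈ ({k : Fin ν → ℤ | (∀ α β, (2 * (ν : ℤ)) ∣ (k α - k β)) ∧ (∑ α, k α) = 0 ∧
        0 < spread ν (by omega) k ∧ spread ν (by omega) k ≤ 2 * (ν : ℤ) * ((ν : ℤ) - 1)} ∪
        {fun _ => (0 : ℤ)}),
      (2 * (ν : ℤ) - spread ν (by omega) k / (ν : ℤ)))
      = 2 * (ν : ℤ) ^ ν := by
  have h : 0 < ν := by omega
  have hν : (ν : ℤ) ≠ 0 := by exact_mod_cast h.ne'
  have hsum := sum_sub_sup_reducedTuples_int h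
  rw [setOf_spread_eq h]
  constructor
  · rw [finsum_mem_coe_finset, sum_erase _ (spread_zero h), sum_image (balancedTuple_injOn h ν),
      sum_congr rfl fun m hm => spread_balancedTuple h (mem_reducedTuples.1 hm).2, ← mul_sum]
    rw [sum_sub_distrib, sum_const, nsmul_eq_mul, card_reducedTuples ν ν h] at hsum
    linear_combination (-2 * (ν : ℤ)) * hsum
  · have hunion : ((((reducedTuples ν ν).image (balancedTuple ν)).erase fun _ => 0 :
        Finset (Fin ν → ℤ)) : Set (Fin ν → ℤ)) ∪ {fun _ => (0 : ℤ)} =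
        ((reducedTuples ν ν).image (balancedTuple ν) : Finset (Fin ν → ℤ)) := by
      rw [coe_erase, Set.sdiff_union_self, Set.union_eq_left, Set.singleton_subset_iff]
      exact zero_mem_image_balancedTuple h
    rw [hunion, finsum_mem_coe_finset, sum_image (balancedTuple_injOn h ν), ← hsum, mul_sum]
    refine sum_congr rfl fun m hm => ?_
    rw [spread_balancedTuple h (mem_reducedTuples.1 hm).2, mul_comm 2 (ν : ℤ), mul_assoc,
      Int.mul_ediv_cancel_left _ hν]
    ring
end
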